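/- arXiv:1408.5027 — 6 statements merged into one kernel-verified Lean document; each statement's English description precedes it below -/
import Mathlib

section
/- For all positive integers d and n, the equilateral dimension e_d(n) of the n-dimensional hypercube satisfies e_d(n) ≤ n + 1. -/
open Filter

/-- A finite subset `S` of the `n`-dimensional hypercube (binary sequences of
length `n`) is `d`-equilateral if it is nonempty and any two distinct points
have Hamming distance exactly `d`. -/
def IsEquilateralSet {n : ℕ} (d : ℕ) (S : Finset (Fin n → Bool)) : Prop :=
  S.Nonempty ∧ ∀ x ∈ S, ∀ y ∈ S, x ≠ y → hammingDist x y = d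

/-- `equilateralDim d n` is the maximal size of a `d`-equilateral subset of the
`n`-dimensional hypercube. -/
noncomputable def equilateralDim (d n : ℕ) : ℕ :=
  sSup {m : ℕ | ∃ S : Finset (Fin n → Bool), IsEquilateralSet d S ∧ S.card = m}

/-- The `±1` vector of a binary sequence, extended by one more coordinate equal to `1`. -/
def signVector {n : ℕ} (x : Fin n → Bool) : Option (Fin n) → ℚ
  | none => 1
  | some i => if x i then 1 else -1

theorem sum_signVector_mul {n : ℕ} (x y : Fin n → Bool) :
    ∑ i, signVector x (some i) * signVector y (some i) = n - 2 * hammingDist x y := by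
  have h : ∀ i, signVector x (some i) * signVector y (some i)
      = 1 - 2 * (if x i ≠ y i then 1 else 0) := fun i => by
    simp only [signVector]
    cases x i <;> cases y i <;> norm_num
  simp only [h, Finset.sum_sub_distrib, ← Finset.mul_sum, Finset.sum_boole, hammingDist]
  simp

theorem IsEquilateralSet.linearIndependent_signVector {n d : ℕ} (hd : 0 < d)
    {S : Finset (Fin n → Bool)} (hS : IsEquilateralSet d S) :
    LinearIndependent ℚ (fun x : S => signVector x.1) := by
  rw [Fintype.linearIndependent_iff]
  intro a ha y
  have hcoord : ∀ j, ∑ x, a x * signVector x.1 j = 0 := fun j => by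
    simpa using congrFun ha j
  have hsum : ∑ x, a x = 0 := by simpa [signVector] using hcoord none
  have hinner : ∑ x : S, a x * ∑ i, signVector x.1 (some i) * signVector y.1 (some i) = 0 := by
    simp only [Finset.mul_sum, ← mul_assoc]
    rw [Finset.sum_comm]
    exact Finset.sum_eq_zero fun i _ => by rw [← Finset.sum_mul, hcoord, zero_mul]
  have hterm : ∀ x : S, a x * ∑ i, signVector x.1 (some i) * signVector y.1 (some i)
      = a x * (n - 2 * d) + if x = y then 2 * d * a x else 0 := fun x => by
    rw [sum_signVector_mul]
    split_ifs with h
    · subst h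
      simp only [hammingDist_self]
      push_cast
      ring
    · rw [hS.2 x.1 x.2 y.1 y.2 (fun e => h (Subtype.ext e)), add_zero]
  simp only [hterm, Finset.sum_add_distrib, ← Finset.sum_mul, hsum] at hinner
  simpa [hd.ne'] using hinner

theorem IsEquilateralSet.card_le_succ {n d : ℕ} (hd : 0 < d)
    {S : Finset (Fin n → Bool)} (hS : IsEquilateralSet d S) : S.card ≤ n + 1 := by
  simpa using (hS.linearIndependent_signVector hd).fintype_card_le_finrank

theorem equilateralDim_le_succ (d n : ℕ) (hd : 0 < d) (hn : 0 < n) :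
    equilateralDim d n ≤ n + 1 := by
  refine csSup_le' ?_
  rintro _ ⟨S, hS, rfl⟩
  exact hS.card_le_succ hd
end

section
/- Let γ be a real number with 0 < γ ≤ 1/2 and define g(γ) := limsup_{n→∞} e_{⌊γn⌋}(n)/n. Then 2γ ≤ g(γ) ≤ 1. -/
open Filter

/-- The inner product of the `±1`-vectors attached to two binary words. -/
theorem sum_sign_mul_sign {ι : Type*} [Fintype ι] (x y : ι → Bool) :
    ∑ i, (if x i then (1 : ℝ) else -1) * (if y i then (1 : ℝ) else -1) =
      Fintype.card ι - 2 * hammingDist x y := by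
  have h : ∀ i, (if x i then (1 : ℝ) else -1) * (if y i then (1 : ℝ) else -1) =
      1 - 2 * (if x i ≠ y i then 1 else 0) := by
    intro i
    cases x i <;> cases y i <;> norm_num
  simp_rw [h, Finset.sum_sub_distrib, ← Finset.mul_sum, Finset.sum_boole]
  simp [hammingDist]

theorem IsEquilateralSet.card_le {n d : ℕ} {S : Finset (Fin n → Bool)}
    (hS : IsEquilateralSet d S) (hd : 0 < d) : S.card ≤ n + 1 := by
  let v : S → Option (Fin n) → ℝ := fun x o => o.elim 1 fun i => if x.1 i then 1 else -1
  have hv : LinearIndependent ℝ v := by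
    rw [Fintype.linearIndependent_iff]
    intro c hc y
    have hsum : ∑ x, c x = 0 := by
      simpa [v, Finset.sum_apply] using congrFun hc none
    have hcoord (i : Fin n) : ∑ x, c x * (if x.1 i then (1 : ℝ) else -1) = 0 := by
      simpa only [v, Finset.sum_apply, Pi.smul_apply, smul_eq_mul, Option.elim, Pi.zero_apply]
        using congrFun hc (some i)
    have hinner : ∑ x, c x * ((n : ℝ) - 2 * hammingDist x.1 y.1) = 0 := by
      calc ∑ x, c x * ((n : ℝ) - 2 * hammingDist x.1 y.1)
          = ∑ x, ∑ i, c x * (if x.1 i then (1 : ℝ) else -1) * (if y.1 i then (1 : ℝ) else -1) := by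
            refine Finset.sum_congr rfl fun x _ => ?_
            have h := sum_sign_mul_sign x.1 y.1
            rw [Fintype.card_fin] at h
            rw [← h, Finset.mul_sum]
            exact Finset.sum_congr rfl fun i _ => (mul_assoc _ _ _).symm
        _ = 0 := by
            rw [Finset.sum_comm]
            refine Finset.sum_eq_zero fun i _ => ?_
            rw [← Finset.sum_mul, hcoord, zero_mul]
    have hterm (x : S) : c x * ((n : ℝ) - 2 * hammingDist x.1 y.1) =
        c x * (n - 2 * d) + if x = y then c x * (2 * d) else 0 := by
      split_ifs with hxy
      · subst hxy
        rw [hammingDist_self]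
        push_cast
        ring
      · rw [hS.2 x.1 x.2 y.1 y.2 fun h => hxy (Subtype.ext h), add_zero]
    simp_rw [hterm, Finset.sum_add_distrib, ← Finset.sum_mul, hsum] at hinner
    simpa [hd.ne'] using hinner
  simpa using hv.fintype_card_le_finrank

theorem equilateralDim_le {n d : ℕ} (hd : 0 < d) : equilateralDim d n ≤ n + 1 := by
  refine csSup_le ⟨1, {fun _ => false}, ⟨by simp, by simp⟩, by simp⟩ ?_
  rintro _ ⟨S, hS, rfl⟩
  exact hS.card_le hd

theorem IsEquilateralSet.card_le_equilateralDim {n d : ℕ} {S : Finset (Fin n → Bool)}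
    (hS : IsEquilateralSet d S) : S.card ≤ equilateralDim d n := by
  refine le_csSup ⟨Fintype.card (Fin n → Bool), ?_⟩ ⟨S, hS, rfl⟩
  rintro _ ⟨T, _, rfl⟩
  exact T.card_le_univ

theorem hammingDist_extend {ι κ : Type*} [Fintype ι] [Fintype κ] (e : ι ↪ κ) (x y : ι → Bool) :
    hammingDist (Function.extend e x fun _ => false) (Function.extend e y fun _ => false) =
      hammingDist x y := by
  classical
  unfold hammingDist
  rw [← Finset.card_map e]
  congr 1
  ext j
  by_cases hj : ∃ i, e i = j
  · obtain ⟨i, rfl⟩ := hj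
    simp [e.injective.extend_apply]
  · have hj' : ∀ i, e i ≠ j := fun i hi => hj ⟨i, hi⟩
    simp [hj']

/-- An equidistant family of words indexed by `α` over a coordinate set that fits into `n`
coordinates bounds `equilateralDim` from below. -/
theorem card_le_equilateralDim {α ι : Type*} [Fintype α] [Nonempty α] [Fintype ι] {n d : ℕ}
    (hd : 0 < d) (hn : Fintype.card ι ≤ n) (f : α → ι → Bool)
    (hf : ∀ a b, a ≠ b → hammingDist (f a) (f b) = d) :
    Fintype.card α ≤ equilateralDim d n := by
  classical
  obtain ⟨e⟩ : Nonempty (ι ↪ Fin n) :=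
    Function.Embedding.nonempty_of_card_le (by simpa using hn)
  let F : α → Fin n → Bool := fun a => Function.extend e (f a) fun _ => false
  have hF : ∀ a b, a ≠ b → hammingDist (F a) (F b) = d := fun a b hab =>
    (hammingDist_extend e _ _).trans (hf a b hab)
  have hinj : Function.Injective F := by
    intro a b hab
    by_contra hne
    have h := hF a b hne
    rw [hab, hammingDist_self] at h
    omega
  have hS : IsEquilateralSet d (Finset.univ.image F) := by
    refine ⟨Finset.univ_nonempty.image F, ?_⟩
    simp only [Finset.mem_image, Finset.mem_univ, true_and]
    rintro _ ⟨a, rfl⟩ _ ⟨b, rfl⟩ hab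
    exact hF a b fun h => hab (congrArg F h)
  have h := hS.card_le_equilateralDim
  rwa [Finset.card_image_of_injective _ hinj, Finset.card_univ] at h

/-- The words of the Hadamard code are equidistant. -/
theorem hammingDist_hadamard {m : ℕ} {a b : Fin (m + 1) → ZMod 2} (hab : a ≠ b) :
    hammingDist (fun x : Fin (m + 1) → ZMod 2 => decide (a ⬝ᵥ x = 0))
      (fun x => decide (b ⬝ᵥ x = 0)) = 2 ^ m := by
  obtain ⟨i, hi⟩ := Function.ne_iff.mp hab
  have hdec : ∀ s t : ZMod 2, decide (s = 0) ≠ decide (t = 0) ↔ s ≠ t := by decide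
  have hflip : ∀ s t u v : ZMod 2, u ≠ v → (s ≠ t ↔ ¬ s + u ≠ t + v) := by decide
  let p : (Fin (m + 1) → ZMod 2) → Prop := fun x => a ⬝ᵥ x ≠ b ⬝ᵥ x
  have hp (x) : p x ↔ ¬ p (x + Pi.single i 1) := by
    simp only [p, dotProduct_add, dotProduct_single, mul_one]
    exact hflip _ _ _ _ hi
  have hcard : (Finset.univ.filter p).card = (Finset.univ.filter fun x => ¬ p x).card :=
    Finset.card_equiv (Equiv.addRight (Pi.single i 1)) fun x => by
      simpa using hp x
  have htotal := Finset.card_filter_add_card_filter_not (s := Finset.univ) p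
  have huniv : (Finset.univ : Finset (Fin (m + 1) → ZMod 2)).card = 2 ^ (m + 1) := by
    simp [ZMod.card]
  have hdist : hammingDist (fun x : Fin (m + 1) → ZMod 2 => decide (a ⬝ᵥ x = 0))
      (fun x => decide (b ⬝ᵥ x = 0)) = (Finset.univ.filter p).card := by
    unfold hammingDist
    simp only [hdec, p]
  rw [hdist]
  rw [huniv, pow_succ] at htotal
  omega

theorem two_pow_succ_le_equilateralDim {m n : ℕ} (hn : 2 ^ (m + 1) ≤ n) :
    2 ^ (m + 1) ≤ equilateralDim (2 ^ m) n := by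
  have h := card_le_equilateralDim (α := Fin (m + 1) → ZMod 2) (n := n) (d := 2 ^ m)
    (by positivity) (by simpa [ZMod.card] using hn)
    (fun a x => decide (a ⬝ᵥ x = 0)) fun a b hab => hammingDist_hadamard hab
  simpa [ZMod.card] using h

theorem limsup_equilateralDim_linear_small_gamma (γ : ℝ) (h1 : 0 < γ) (h2 : γ ≤ 1 / 2) :
    2 * γ ≤ limsup (fun n : ℕ => (equilateralDim ⌊γ * n⌋₊ n : ℝ) / n) atTop ∧
    limsup (fun n : ℕ => (equilateralDim ⌊γ * n⌋₊ n : ℝ) / n) atTop ≤ 1 := by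
  set u : ℕ → ℝ := fun n => (equilateralDim ⌊γ * n⌋₊ n : ℝ) / n with hu
  have hlim : Tendsto (fun n : ℕ => 1 + 1 / (n : ℝ)) atTop (nhds 1) := by
    simpa using tendsto_one_div_atTop_nhds_zero_nat.const_add (1 : ℝ)
  have hle : ∀ᶠ n in atTop, u n ≤ 1 + 1 / (n : ℝ) := by
    filter_upwards [eventually_ge_atTop ⌈1 / γ⌉₊, eventually_gt_atTop 0] with n hn hn0
    have hn0' : (0 : ℝ) < n := by exact_mod_cast hn0
    have hd : 0 < ⌊γ * n⌋₊ := by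
      rw [Nat.floor_pos, mul_comm, ← div_le_iff₀ h1]
      exact Nat.ceil_le.mp hn
    have he : (equilateralDim ⌊γ * n⌋₊ n : ℝ) ≤ n + 1 := by exact_mod_cast equilateralDim_le hd
    calc u n ≤ (n + 1) / n := div_le_div_of_nonneg_right he hn0'.le
      _ = 1 + 1 / (n : ℝ) := by field_simp
  have hbdd : IsBoundedUnder (· ≤ ·) atTop u := hlim.isBoundedUnder_le.mono_le hle
  have hcobdd : IsCoboundedUnder (· ≤ ·) atTop u :=
    isCoboundedUnder_le_of_le atTop (x := 0) fun n => by positivity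
  refine ⟨le_of_forall_lt_imp_le_of_dense fun c hc => ?_,
    (limsup_le_limsup hle hcobdd hlim.isBoundedUnder_le).trans hlim.limsup_eq.le⟩
  refine le_limsup_of_frequently_le ?_ hbdd
  have hpow : Tendsto (fun k : ℕ => (2 : ℝ) ^ k) atTop atTop :=
    tendsto_pow_atTop_atTop_of_one_lt one_lt_two
  have hindex : Tendsto (fun k : ℕ => ⌈(2 : ℝ) ^ k / γ⌉₊) atTop atTop :=
    tendsto_nat_ceil_atTop.comp (hpow.atTop_div_const h1)
  refine hindex.frequently (Eventually.frequently ?_)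
  filter_upwards [hpow.eventually_ge_atTop (c * γ / (2 * γ - c))] with k hk
  set n := ⌈(2 : ℝ) ^ k / γ⌉₊
  have hpos : (0 : ℝ) < 2 ^ k := by positivity
  have hlow : (2 : ℝ) ^ k ≤ γ * n := by
    rw [mul_comm, ← div_le_iff₀ h1]
    exact Nat.le_ceil _
  have hupp : γ * n < 2 ^ k + γ := by
    have h := Nat.ceil_lt_add_one (div_pos hpos h1).le
    calc γ * n < γ * (2 ^ k / γ + 1) := mul_lt_mul_of_pos_left h h1
      _ = 2 ^ k + γ := by field_simp
  have hn0 : (0 : ℝ) < n := pos_of_mul_pos_right (hpos.trans_le hlow) h1.le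
  have hfloor : ⌊γ * n⌋₊ = 2 ^ k := by
    rw [Nat.floor_eq_iff (by positivity)]
    push_cast
    exact ⟨hlow, by linarith⟩
  have hsize : 2 ^ (k + 1) ≤ n := by
    have h : (2 : ℝ) ^ (k + 1) ≤ n := by
      rw [pow_succ]
      nlinarith
    exact_mod_cast h
  have hdim : (2 : ℝ) ^ (k + 1) ≤ equilateralDim (2 ^ k) n := by
    exact_mod_cast two_pow_succ_le_equilateralDim hsize
  simp only [hu, hfloor]
  rw [le_div_iff₀ hn0]
  refine le_trans ?_ hdim
  rw [div_le_iff₀ (by linarith)] at hk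
  rw [pow_succ]
  rcases le_total c 0 with hc0 | hc0
  · nlinarith
  · refine le_of_mul_le_mul_left ?_ h1
    nlinarith [mul_le_mul_of_nonneg_left hupp.le hc0]
end

section
/- Let γ be a real number with 1/2 < γ ≤ 1 and define g(γ) := limsup_{n→∞} e_{⌊γn⌋}(n)/n. Then g(γ) = 0. -/
open Filter

/-- Twice the Hamming distance of two binary words, through the inner product of their
`±1`-encodings. -/
lemma two_mul_hammingDist_eq {n : ℕ} (x y : Fin n → Bool) :
    (2 * hammingDist x y : ℤ) =
      n - ∑ i, (if x i then 1 else -1 : ℤ) * (if y i then 1 else -1) := by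
  have hcard : (n : ℤ) = ∑ _i : Fin n, 1 := by simp
  rw [hammingDist, Finset.card_filter, hcard, ← Finset.sum_sub_distrib, Nat.cast_sum,
    Finset.mul_sum]
  refine Finset.sum_congr rfl fun i _ => ?_
  cases x i <;> cases y i <;> simp

/-- The averaging inequality behind the Plotkin bound. -/
lemma two_mul_sum_hammingDist_le {n : ℕ} (S : Finset (Fin n → Bool)) :
    2 * ∑ x ∈ S, ∑ y ∈ S, (hammingDist x y : ℤ) ≤ n * (S.card : ℤ) ^ 2 := by
  have hgram : ∑ x ∈ S, ∑ y ∈ S,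
      ∑ i, (if x i then 1 else -1 : ℤ) * (if y i then 1 else -1) =
        ∑ i, (∑ x ∈ S, (if x i then 1 else -1 : ℤ)) ^ 2 := by
    simp_rw [sq, Finset.sum_mul_sum]
    rw [Finset.sum_comm (s := Finset.univ)]
    refine Finset.sum_congr rfl fun x _ => ?_
    rw [Finset.sum_comm]
  have hnonneg : 0 ≤ ∑ i, (∑ x ∈ S, (if x i then 1 else -1 : ℤ)) ^ 2 :=
    Finset.sum_nonneg fun i _ => sq_nonneg _
  simp_rw [Finset.mul_sum, two_mul_hammingDist_eq, Finset.sum_sub_distrib]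
  rw [hgram]
  simp only [Finset.sum_const, nsmul_eq_mul]
  linarith

/-- The Plotkin bound for equilateral sets. -/
lemma IsEquilateralSet.card_mul_le {n d : ℕ} {S : Finset (Fin n → Bool)}
    (hS : IsEquilateralSet d S) : (S.card : ℤ) * (2 * d - n) ≤ 2 * d := by
  have hrow : ∀ x ∈ S, ∑ y ∈ S, (hammingDist x y : ℤ) = ((S.card : ℤ) - 1) * d := by
    intro x hx
    rw [← Finset.add_sum_erase S _ hx, hammingDist_self,
      Finset.sum_congr rfl fun y hy => congrArg (Nat.cast (R := ℤ))
        (hS.2 x hx y (Finset.mem_of_mem_erase hy) (Finset.ne_of_mem_erase hy).symm),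
      Finset.sum_const, nsmul_eq_mul, Finset.cast_card_erase_of_mem hx]
    simp
  have hle := two_mul_sum_hammingDist_le S
  rw [Finset.sum_congr rfl hrow, Finset.sum_const, nsmul_eq_mul] at hle
  have hpos : (0 : ℤ) < S.card := by exact_mod_cast hS.1.card_pos
  have : (S.card : ℤ) * (2 * (((S.card : ℤ) - 1) * d)) ≤ S.card * (n * S.card) := by
    linarith
  linarith [le_of_mul_le_mul_left this hpos]

lemma exists_isEquilateralSet_card_eq_equilateralDim (d n : ℕ) :
    ∃ S : Finset (Fin n → Bool), IsEquilateralSet d S ∧ S.card = equilateralDim d n := by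
  refine Nat.sSup_mem
    (s := {m : ℕ | ∃ S : Finset (Fin n → Bool), IsEquilateralSet d S ∧ S.card = m}) ?_ ?_
  · refine ⟨1, {fun _ => false}, ⟨Finset.singleton_nonempty _, ?_⟩, Finset.card_singleton _⟩
    intro x hx y hy hxy
    exact absurd ((Finset.mem_singleton.1 hx).trans (Finset.mem_singleton.1 hy).symm) hxy
  · refine ⟨Fintype.card (Fin n → Bool), ?_⟩
    rintro m ⟨S, -, rfl⟩
    exact Finset.card_le_univ S

lemma equilateralDim_mul_le (d n : ℕ) :
    (equilateralDim d n : ℝ) * (2 * d - n) ≤ 2 * d := by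
  obtain ⟨S, hS, hcard⟩ := exists_isEquilateralSet_card_eq_equilateralDim d n
  rw [← hcard]
  exact_mod_cast hS.card_mul_le

/-- For `γ > 1 / 2` the equilateral dimension stays bounded. -/
lemma equilateralDim_floor_mul_le {γ : ℝ} (h1 : 1 / 2 < γ) (h2 : γ ≤ 1) {n : ℕ}
    (hn : 4 / (2 * γ - 1) ≤ n) :
    (equilateralDim ⌊γ * n⌋₊ n : ℝ) ≤ 4 / (2 * γ - 1) := by
  have hγ : 0 < 2 * γ - 1 := by linarith
  have hn0 : (0 : ℝ) < n := lt_of_lt_of_le (by positivity) hn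
  have hn4 : 4 ≤ n * (2 * γ - 1) := (div_le_iff₀ hγ).1 hn
  have hfloor := Nat.floor_le (a := γ * n) (by nlinarith)
  have hlt := Nat.lt_floor_add_one (γ * (n : ℝ))
  have hbound := equilateralDim_mul_le ⌊γ * (n : ℝ)⌋₊ n
  have he : (0 : ℝ) ≤ equilateralDim ⌊γ * (n : ℝ)⌋₊ n := Nat.cast_nonneg _
  have hhalf : n * (2 * γ - 1) / 2 ≤ 2 * (⌊γ * (n : ℝ)⌋₊ : ℝ) - n := by linarith
  have hγn : γ * n ≤ n := by nlinarith
  have hmul := mul_le_mul_of_nonneg_left hhalf he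
  rw [le_div_iff₀ hγ]
  refine le_of_mul_le_mul_right ?_ hn0
  linarith

theorem limsup_equilateralDim_linear_large_gamma (γ : ℝ) (h1 : 1 / 2 < γ) (h2 : γ ≤ 1) :
    limsup (fun n : ℕ => (equilateralDim ⌊γ * n⌋₊ n : ℝ) / n) atTop = 0 := by
  refine Tendsto.limsup_eq ?_
  refine squeeze_zero' (Eventually.of_forall fun n => by positivity) ?_
    (tendsto_const_div_atTop_nhds_zero_nat (4 / (2 * γ - 1)))
  filter_upwards [tendsto_natCast_atTop_atTop.eventually_ge_atTop (4 / (2 * γ - 1))] with n hn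
  exact div_le_div_of_nonneg_right (equilateralDim_floor_mul_le h1 h2 hn) n.cast_nonneg
end

section
/- Let d be an odd positive integer. Then h(d) := limsup_{n→∞} e_d(n)/n = 0; in fact the sequence e_d(n)/n tends to 0 as n → ∞. -/
open Filter

/-- The perimeter of a triangle in the hypercube is even. -/
theorem even_hammingDist_add_add {n : ℕ} (x y z : Fin n → Bool) :
    Even (hammingDist x y + hammingDist y z + hammingDist x z) := by
  simp only [hammingDist, Finset.card_filter, ← Finset.sum_add_distrib]
  refine Finset.even_sum _ fun i _ => ?_
  cases x i <;> cases y i <;> cases z i <;> decide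

theorem IsEquilateralSet.card_le_two {n d : ℕ} (hodd : Odd d) {S : Finset (Fin n → Bool)}
    (hS : IsEquilateralSet d S) : S.card ≤ 2 := by
  by_contra! h
  obtain ⟨x, y, z, hx, hy, hz, hxy, hxz, hyz⟩ := Finset.two_lt_card_iff.mp h
  have heven := even_hammingDist_add_add x y z
  rw [hS.2 x hx y hy hxy, hS.2 y hy z hz hyz, hS.2 x hx z hz hxz] at heven
  grind

theorem equilateralDim_le_two_of_odd {d : ℕ} (hodd : Odd d) (n : ℕ) :
    equilateralDim d n ≤ 2 := by
  refine csSup_le' ?_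
  rintro _ ⟨S, hS, rfl⟩
  exact hS.card_le_two hodd

theorem equilateralDim_odd_ratio_tendsto_zero (d : ℕ) (hd : 0 < d) (hodd : Odd d) :
    Tendsto (fun n : ℕ => (equilateralDim d n : ℝ) / n) atTop (nhds 0) ∧
    limsup (fun n : ℕ => (equilateralDim d n : ℝ) / n) atTop = 0 := by
  have h : Tendsto (fun n : ℕ => (equilateralDim d n : ℝ) / n) atTop (nhds 0) := by
    refine squeeze_zero (fun n => by positivity) (fun n => ?_)
      (tendsto_const_div_atTop_nhds_zero_nat (2 : ℝ))
    gcongr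
    exact_mod_cast equilateralDim_le_two_of_odd hodd n
  exact ⟨h, h.limsup_eq⟩
end

section
/- Let d be an even positive integer. Then there exists a positive integer N such that for all n ≥ N one has e_d(n) = ⌊2n/d⌋. -/
open Filter

/-- In a large family of `2k`-sets with pairwise intersections of size `k`, some `k`-set is
contained in every member (the sunflower dichotomy). -/
theorem exists_common_subset_of_card_inter_eq {α : Type*} [DecidableEq α] {k : ℕ}
    {F : Finset (Finset α)} (hcard : ∀ A ∈ F, A.card = 2 * k)
    (hinter : ∀ A ∈ F, ∀ B ∈ F, A ≠ B → (A ∩ B).card = k)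
    (hF : 2 ^ (2 * k) * (2 * k) + 1 < F.card) :
    ∃ K : Finset α, K.card = k ∧ ∀ C ∈ F, K ⊆ C := by
  obtain ⟨A, hA⟩ : F.Nonempty := Finset.card_pos.mp (by omega)
  obtain ⟨K, -, hG⟩ := Finset.exists_lt_card_fiber_of_mul_lt_card_of_maps_to
    (s := F.erase A) (t := A.powerset) (f := fun B => A ∩ B) (n := 2 * k)
    (fun B _ => Finset.mem_powerset.mpr Finset.inter_subset_left)
    (by rw [Finset.card_powerset, hcard A hA, Finset.card_erase_of_mem hA]; omega)
  set G := (F.erase A).filter (fun B => A ∩ B = K) with hGdef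
  have hmem : ∀ B ∈ G, B ≠ A ∧ B ∈ F ∧ A ∩ B = K := by
    intro B hB
    simpa [hGdef, and_assoc] using hB
  have hKsub : ∀ B ∈ G, K ⊆ B := fun B hB => (hmem B hB).2.2 ▸ Finset.inter_subset_right
  have hK : K.card = k := by
    obtain ⟨B, hB⟩ : G.Nonempty := Finset.card_pos.mp (by omega)
    obtain ⟨hne, hBF, hBK⟩ := hmem B hB
    rw [← hBK]
    exact hinter A hA B hBF hne.symm
  refine ⟨K, hK, fun C hC => ?_⟩
  by_contra hKC
  have hdisj : (G : Set (Finset α)).PairwiseDisjoint (fun B => C ∩ (B \ K)) := by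
    intro B hB B' hB' hne
    have heq : K = B ∩ B' := Finset.eq_of_subset_of_card_le
      (Finset.subset_inter (hKsub B hB) (hKsub B' hB'))
      (by rw [hinter B (hmem B hB).2.1 B' (hmem B' hB').2.1 hne, hK])
    refine Finset.disjoint_left.mpr fun x hx hx' => ?_
    simp only [Finset.mem_inter, Finset.mem_sdiff] at hx hx'
    exact hx.2.2 (heq ▸ Finset.mem_inter.mpr ⟨hx.2.1, hx'.2.1⟩)
  have hne : ∀ B ∈ G, (C ∩ (B \ K)).Nonempty := by
    intro B hB
    by_contra hempty
    have hCB : C ≠ B := fun h => hKC (h ▸ hKsub B hB)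
    have hsub : C ∩ B ⊆ K := by
      intro x hx
      by_contra hxK
      rw [Finset.mem_inter] at hx
      exact hempty ⟨x, by simp [hx.1, hx.2, hxK]⟩
    have heq : C ∩ B = K := Finset.eq_of_subset_of_card_le hsub
      (by rw [hinter C hC B (hmem B hB).2.1 hCB, hK])
    exact hKC (heq ▸ Finset.inter_subset_left)
  have h1 := Finset.card_le_card_biUnion hdisj hne
  have h2 : (G.biUnion fun B => C ∩ (B \ K)).card ≤ C.card :=
    Finset.card_le_card (Finset.biUnion_subset.mpr fun _ _ => Finset.inter_subset_left)
  rw [hcard C hC] at h2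
  omega

/-- A sunflower of `2k`-sets with a kernel of size `k` covers `(|F| + 1) k` points. -/
theorem card_add_one_mul_le_of_common_subset {α : Type*} [DecidableEq α] [Fintype α] {k : ℕ}
    {F : Finset (Finset α)} (hcard : ∀ A ∈ F, A.card = 2 * k)
    (hinter : ∀ A ∈ F, ∀ B ∈ F, A ≠ B → (A ∩ B).card = k)
    {K : Finset α} (hK : K.card = k) (hsub : ∀ C ∈ F, K ⊆ C) :
    (F.card + 1) * k ≤ Fintype.card α := by
  have hdisj : (F : Set (Finset α)).PairwiseDisjoint (fun B => B \ K) := by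
    intro B hB B' hB' hne
    have heq : K = B ∩ B' := Finset.eq_of_subset_of_card_le
      (Finset.subset_inter (hsub B hB) (hsub B' hB')) (by rw [hinter B hB B' hB' hne, hK])
    refine Finset.disjoint_left.mpr fun x hx hx' => ?_
    simp only [Finset.mem_sdiff] at hx hx'
    exact hx.2 (heq ▸ Finset.mem_inter.mpr ⟨hx.1, hx'.1⟩)
  have hpetals : (F.biUnion fun B => B \ K).card = F.card * k := by
    rw [Finset.card_biUnion hdisj]
    refine Finset.sum_const_nat fun B hB => ?_
    rw [Finset.card_sdiff_of_subset (hsub B hB), hcard B hB, hK]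
    omega
  have hdisjK : Disjoint (F.biUnion fun B => B \ K) K := by
    rw [Finset.disjoint_biUnion_left]
    exact fun B _ => Finset.sdiff_disjoint
  calc (F.card + 1) * k = ((F.biUnion fun B => B \ K) ∪ K).card := by
        rw [Finset.card_union_of_disjoint hdisjK, hpetals, hK]; ring
    _ ≤ Fintype.card α := Finset.card_le_univ _

/-- A `2k`-equilateral set in the `n`-cube has bounded size or at most `n / k` points. -/
theorem IsEquilateralSet.card_le_or_card_mul_le {n k : ℕ} {S : Finset (Fin n → Bool)}
    (hS : IsEquilateralSet (2 * k) S) :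
    S.card ≤ 2 ^ (2 * k) * (2 * k) + 2 ∨ S.card * k ≤ n := by
  obtain ⟨⟨x₀, hx₀⟩, hdist⟩ := hS
  set supp : (Fin n → Bool) → Finset (Fin n) :=
    fun x => Finset.univ.filter fun i => x i ≠ x₀ i with hsupp
  have hinj : Function.Injective supp := by
    intro x y hxy
    funext i
    have := Finset.ext_iff.mp hxy i
    simp only [hsupp, Finset.mem_filter, Finset.mem_univ, true_and] at this
    revert this
    cases x i <;> cases y i <;> cases x₀ i <;> simp
  have hcard_supp : ∀ x ∈ S.erase x₀, (supp x).card = 2 * k := fun x hx =>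
    hdist x (Finset.mem_of_mem_erase hx) x₀ hx₀ (Finset.ne_of_mem_erase hx)
  have hinter_supp : ∀ x ∈ S.erase x₀, ∀ y ∈ S.erase x₀, x ≠ y →
      (supp x ∩ supp y).card = k := by
    intro x hx y hy hne
    have hxy := hdist x (Finset.mem_of_mem_erase hx) y (Finset.mem_of_mem_erase hy) hne
    have hunion : (supp x \ supp y ∪ supp y \ supp x).card = 2 * k := by
      rw [← hxy, hammingDist]
      congr 1
      ext i
      simp only [hsupp, Finset.mem_union, Finset.mem_sdiff, Finset.mem_filter,
        Finset.mem_univ, true_and]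
      cases x i <;> cases y i <;> cases x₀ i <;> simp
    rw [Finset.card_union_of_disjoint disjoint_sdiff_sdiff] at hunion
    have h1 := Finset.card_sdiff_add_card_inter (supp x) (supp y)
    have h2 := Finset.card_sdiff_add_card_inter (supp y) (supp x)
    rw [Finset.inter_comm] at h2
    have h3 := hcard_supp x hx
    have h4 := hcard_supp y hy
    omega
  set F := (S.erase x₀).image supp with hF
  have hFcard : F.card + 1 = S.card := by
    rw [hF, Finset.card_image_of_injective _ hinj, Finset.card_erase_add_one hx₀]
  have hcard : ∀ A ∈ F, A.card = 2 * k := by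
    rw [hF, Finset.forall_mem_image]
    exact fun x hx => hcard_supp x hx
  have hinter : ∀ A ∈ F, ∀ B ∈ F, A ≠ B → (A ∩ B).card = k := by
    simp only [hF, Finset.forall_mem_image]
    exact fun x hx y hy hne => hinter_supp x hx y hy fun h => hne (h ▸ rfl)
  refine or_iff_not_imp_left.mpr fun hlarge => ?_
  obtain ⟨K, hK, hsub⟩ := exists_common_subset_of_card_inter_eq hcard hinter (by omega)
  simpa [hFcard] using card_add_one_mul_le_of_common_subset hcard hinter hK hsub

/-- The indicator functions of `m` disjoint blocks of length `k` form a `2k`-equilateral set. -/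
theorem exists_isEquilateralSet_card_eq {n k m : ℕ} (hk : 0 < k) (hm : 0 < m)
    (hmn : m * k ≤ n) :
    ∃ S : Finset (Fin n → Bool), IsEquilateralSet (2 * k) S ∧ S.card = m := by
  set block : Fin m → Fin n → Bool := fun j i => decide ((i : ℕ) / k = j) with hblock
  have hcard : ∀ j : Fin m,
      (Finset.univ.filter fun i : Fin n => (i : ℕ) / k = j).card = k := by
    intro j
    rw [← Finset.card_map Fin.valEmbedding]
    have : (Finset.univ.filter fun i : Fin n => (i : ℕ) / k = j).map Fin.valEmbedding
        = Finset.Ico ((j : ℕ) * k) ((j + 1) * k) := by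
      ext i
      have hjm : ((j : ℕ) + 1) * k ≤ m * k := Nat.mul_le_mul_right k j.2
      simp only [Finset.mem_map, Finset.mem_filter, Finset.mem_univ, true_and,
        Fin.valEmbedding_apply, Finset.mem_Ico]
      constructor
      · rintro ⟨a, ha, rfl⟩
        exact ⟨(Nat.le_div_iff_mul_le hk).mp ha.ge, (Nat.div_lt_iff_lt_mul hk).mp (by omega)⟩
      · intro hi
        have hle := (Nat.le_div_iff_mul_le hk).mpr hi.1
        have hlt := (Nat.div_lt_iff_lt_mul hk).mpr hi.2
        exact ⟨⟨i, by omega⟩, by simp only; omega, rfl⟩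
    rw [this, Nat.card_Ico, add_mul, one_mul, Nat.add_sub_cancel_left]
  have hdist : ∀ j j' : Fin m, j ≠ j' → hammingDist (block j) (block j') = 2 * k := by
    intro j j' hne
    have hne' : (j : ℕ) ≠ j' := Fin.val_ne_of_ne hne
    have hset : (Finset.univ.filter fun i : Fin n => block j i ≠ block j' i)
        = (Finset.univ.filter fun i : Fin n => (i : ℕ) / k = j)
          ∪ (Finset.univ.filter fun i : Fin n => (i : ℕ) / k = j') := by
      ext i
      simp only [hblock, Finset.mem_filter, Finset.mem_univ, true_and, Finset.mem_union, ne_eq,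
        decide_eq_decide]
      omega
    rw [hammingDist, hset, Finset.card_union_of_disjoint, hcard, hcard, two_mul]
    refine Finset.disjoint_filter.mpr fun i _ h h' => hne' (h.symm.trans h')
  have hinj : Function.Injective block := by
    intro j j' h
    by_contra hne
    have := hdist j j' hne
    rw [h, hammingDist_self] at this
    omega
  refine ⟨Finset.univ.image block, ⟨⟨block ⟨0, hm⟩, by simp⟩, ?_⟩, ?_⟩
  · simp only [Finset.forall_mem_image]
    exact fun j _ j' _ hne => hdist j j' fun h => hne (h ▸ rfl)
  · rw [Finset.card_image_of_injective _ hinj, Finset.card_univ, Fintype.card_fin]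

theorem equilateralDim_even_eventually_eq_floor (d : ℕ) (hd : 0 < d) (heven : Even d) :
    ∃ N : ℕ, 0 < N ∧ ∀ n : ℕ, N ≤ n → equilateralDim d n = 2 * n / d := by
  obtain ⟨k, rfl⟩ := heven.exists_two_nsmul
  rw [smul_eq_mul] at hd ⊢
  have hk : 0 < k := by omega
  refine ⟨(2 ^ (2 * k) * (2 * k) + 2) * k, by positivity, fun n hn => ?_⟩
  rw [Nat.mul_div_mul_left _ _ two_pos]
  have hbound : 2 ^ (2 * k) * (2 * k) + 2 ≤ n / k := (Nat.le_div_iff_mul_le hk).mpr hn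
  refine IsGreatest.csSup_eq ⟨?_, ?_⟩
  · exact exists_isEquilateralSet_card_eq hk (by omega) (Nat.div_mul_le_self n k)
  · rintro _ ⟨S, hS, rfl⟩
    rcases hS.card_le_or_card_mul_le with h | h
    · exact h.trans hbound
    · exact (Nat.le_div_iff_mul_le hk).mpr h
end

section
/- For every prime power q, one has e_{2q}(q(q+1)) ≥ q², i.e. the hypercube of dimension q(q+1) contains a 2q-equilateral subset of size q². -/
open Filter

/-- A family of points, any two of which are at distance `d ≠ 0`, bounds `equilateralDim d n`
from below by the size of its index type; the coordinates may be indexed by any type of size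
`n`. -/
theorem card_le_equilateralDim_of_hammingDist_eq {P κ : Type*} [Fintype P] [Nonempty P]
    [Fintype κ] {d n : ℕ} (hd : d ≠ 0) (hn : Fintype.card κ = n) (w : P → κ → Bool)
    (hw : ∀ a b, a ≠ b → hammingDist (w a) (w b) = d) :
    Fintype.card P ≤ equilateralDim d n := by
  classical
  let e : Fin n ≃ κ := (Fintype.equivFinOfCardEq hn).symm
  have hdist : ∀ a b, a ≠ b → hammingDist (w a ∘ e) (w b ∘ e) = d := by
    intro a b hab
    rw [← hw a b hab]
    exact Finset.card_equiv e (by simp)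
  have hinj : Function.Injective fun a => w a ∘ e := by
    intro a b h
    by_contra hab
    have := hdist a b hab
    rw [show w a ∘ e = w b ∘ e from h, hammingDist_self] at this
    exact hd this.symm
  have hS : IsEquilateralSet d (Finset.univ.image fun a => w a ∘ e) := by
    refine ⟨Finset.univ_nonempty.image _, ?_⟩
    simp only [Finset.mem_image, Finset.mem_univ, true_and]
    rintro _ ⟨a, rfl⟩ _ ⟨b, rfl⟩ hab
    exact hdist a b fun h => hab (by rw [h])
  simpa [Finset.card_image_of_injective _ hinj] using hS.card_le_equilateralDim

/-- Replacing every letter of a word by its indicator function doubles Hamming distances. -/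
theorem hammingDist_indicator {ι α : Type*} [Fintype ι] [Fintype α] [DecidableEq α]
    (f g : ι → α) :
    hammingDist (fun x : ι × α => decide (f x.1 = x.2)) (fun x => decide (g x.1 = x.2)) =
      2 * hammingDist f g := by
  have key : ∀ a b : α, (∑ c, if decide (a = c) ≠ decide (b = c) then 1 else 0) =
      if a ≠ b then 2 else 0 := by
    intro a b
    rw [← Finset.card_filter]
    split_ifs with h
    · rw [← Finset.card_pair h]
      congr 1
      ext c
      simp only [Finset.mem_filter, Finset.mem_univ, true_and, Finset.mem_insert,
        Finset.mem_singleton]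
      grind
    · simp [not_not.mp h]
  simp only [hammingDist, Finset.card_filter, Fintype.sum_prod_type, key, Finset.mul_sum]
  simp

/-- The parallel classes of lines of the affine plane over `F` are indexed by `Option F`; this
function sends a class to the label of its line through `p`. -/
def affineLineLabel {F : Type*} [Field F] (p : F × F) : Option F → F
  | none => p.1
  | some m => p.2 + m * p.1

theorem hammingDist_affineLineLabel {F : Type*} [Field F] [Fintype F] [DecidableEq F]
    {a b : F × F} (hab : a ≠ b) :
    hammingDist (affineLineLabel a) (affineLineLabel b) = Fintype.card F := by
  obtain ⟨x, y⟩ := a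
  obtain ⟨x', y'⟩ := b
  simp only [hammingDist, Finset.card_filter]
  rw [Fintype.sum_option]
  simp only [affineLineLabel]
  by_cases hx : x = x'
  · subst hx
    have hy : y ≠ y' := fun h => hab (by rw [h])
    simp [hy]
  · have hx' : x - x' ≠ 0 := sub_ne_zero.mpr hx
    have hm : ∀ m : F, y + m * x ≠ y' + m * x' ↔ m ≠ (y' - y) / (x - x') := by
      intro m
      rw [not_iff_not, eq_div_iff hx']
      constructor <;> intro h <;> linear_combination h
    simp only [hm, ← Finset.card_filter, Finset.filter_ne', Finset.card_erase_of_mem,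
      Finset.mem_univ, Finset.card_univ, ne_eq, hx, not_false_eq_true, if_true]
    have := Fintype.card_pos (α := F)
    omega

theorem card_sq_le_equilateralDim (F : Type*) [Field F] [Fintype F] :
    Fintype.card F ^ 2 ≤
      equilateralDim (2 * Fintype.card F) (Fintype.card F * (Fintype.card F + 1)) := by
  classical
  rw [sq, ← Fintype.card_prod]
  refine card_le_equilateralDim_of_hammingDist_eq (κ := Option F × F) (by simp)
    (by simp [mul_comm]) (fun p x => decide (affineLineLabel p x.1 = x.2)) fun a b hab => ?_
  rw [hammingDist_indicator, hammingDist_affineLineLabel hab]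

theorem equilateralDim_prime_power_base (q : ℕ) (hq : IsPrimePow q) :
    q ^ 2 ≤ equilateralDim (2 * q) (q * (q + 1)) := by
  obtain ⟨_⟩ : Nonempty (Field (Fin q)) := Fintype.nonempty_field_iff.mpr (by simpa using hq)
  simpa using card_sq_le_equilateralDim (Fin q)
end
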